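/- arXiv:1108.2100 — 6 statements merged into one kernel-verified Lean document; each statement's English description precedes it below -/
import Mathlib

section
/- Let B be a group generated by a finite set Y, let A ≤ B be a subgroup, and let U = ⟨B, t | t⁻¹at = a for all a ∈ A⟩ be the HNN extension of B with stable letter t centralizing A, with canonical embedding ι : B → U. Then for every b ∈ B, the word length of ι(b) in U with respect to the generating set ι(Y) ∪ {t} equals the word length of b in B with respect to Y. -/
/-- The word length of `g` with respect to a generating set `S`: the least `n` such that
`g` is a product of `n` elements of `S ∪ S⁻¹`. -/
noncomputable def wordLength {G : Type*} [Group G] (S : Set G) (g : G) : ℕ :=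
  sInf {n | ∃ l : List G, (∀ x ∈ l, x ∈ S ∪ S⁻¹) ∧ l.length = n ∧ l.prod = g}

/-- The canonical embedding of `B` into the HNN extension
`U = ⟨B, t ∣ t⁻¹at = a, a ∈ A⟩` (associated subgroups `A`, `A`, identity isomorphism). -/
def hnnOf {B : Type*} [Group B] (A : Subgroup B) :
    B →* HNNExtension B A A (MulEquiv.refl A) :=
  HNNExtension.of

/-- The generating set `ι(Y) ∪ {t}` of the HNN extension `⟨B, t ∣ t⁻¹at = a, a ∈ A⟩`. -/
def hnnGens {B : Type*} [Group B] (A : Subgroup B) (Y : Set B) :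
    Set (HNNExtension B A A (MulEquiv.refl A)) :=
  (hnnOf A '' Y) ∪ {HNNExtension.t}

/-- The word length of an element `g` of the subgroup generated by `S` is attained by a word. -/
theorem exists_list_length_eq_wordLength {G : Type*} [Group G] {S : Set G} {g : G}
    (hg : g ∈ Subgroup.closure S) :
    ∃ l : List G, (∀ x ∈ l, x ∈ S ∪ S⁻¹) ∧ l.length = wordLength S g ∧ l.prod = g := by
  rw [← Subgroup.mem_toSubmonoid, Subgroup.closure_toSubmonoid] at hg
  obtain ⟨l, hl, hprod⟩ := Submonoid.exists_list_of_mem_closure hg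
  exact Nat.sInf_mem
    (s := {n | ∃ l : List G, (∀ x ∈ l, x ∈ S ∪ S⁻¹) ∧ l.length = n ∧ l.prod = g})
    ⟨l.length, l, hl, rfl, hprod⟩

theorem wordLength_prod_le {G : Type*} [Group G] {S : Set G} {l : List G}
    (hl : ∀ x ∈ l, x ∈ S ∪ S⁻¹) : wordLength S l.prod ≤ l.length :=
  Nat.sInf_le ⟨l, hl, rfl, rfl⟩

/-- Deleting trivial letters does not increase the length of a word. -/
theorem wordLength_prod_le_of_mem_or_eq_one {G : Type*} [Group G] {S : Set G} {l : List G}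
    (hl : ∀ x ∈ l, x ∈ S ∪ S⁻¹ ∨ x = 1) : wordLength S l.prod ≤ l.length := by
  classical
  have hprod : (l.filter (· ≠ 1)).prod = l.prod := by
    clear hl
    induction l with
    | nil => rfl
    | cons x l ih => by_cases hx : x = 1 <;> simp_all
  rw [← hprod]
  refine (wordLength_prod_le fun x hx => ?_).trans (List.length_filter_le _ _)
  obtain ⟨hx, hx1⟩ := List.mem_filter.1 hx
  exact (hl x hx).resolve_right (by simpa using hx1)

/-- A homomorphism sending each generator to a generator or to `1` does not increase
word length. -/
theorem wordLength_map_le {G H : Type*} [Group G] [Group H] {S : Set G} {T : Set H}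
    (f : G →* H) (hf : ∀ x ∈ S, f x ∈ T ∨ f x = 1) {g : G} (hg : g ∈ Subgroup.closure S) :
    wordLength T (f g) ≤ wordLength S g := by
  obtain ⟨l, hl, hlen, rfl⟩ := exists_list_length_eq_wordLength hg
  rw [← hlen, map_list_prod, ← List.length_map (as := l) f]
  refine wordLength_prod_le_of_mem_or_eq_one fun y hy => ?_
  obtain ⟨x, hx, rfl⟩ := List.mem_map.1 hy
  rcases hl x hx with h | h
  · exact (hf x h).imp_left Or.inl
  · refine (hf x⁻¹ h).imp (fun h => Or.inr ?_) fun h => ?_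
    · simpa using h
    · simpa using h

/-- The retraction of `⟨B, t ∣ t⁻¹at = a, a ∈ A⟩` onto `B` that kills `t`. -/
def hnnRetraction {B : Type*} [Group B] (A : Subgroup B) :
    HNNExtension B A A (MulEquiv.refl A) →* B :=
  HNNExtension.lift (MonoidHom.id B) 1 (by simp)

@[simp]
theorem hnnRetraction_hnnOf {B : Type*} [Group B] (A : Subgroup B) (b : B) :
    hnnRetraction A (hnnOf A b) = b := by
  simp [hnnRetraction, hnnOf]

@[simp]
theorem hnnRetraction_t {B : Type*} [Group B] (A : Subgroup B) :
    hnnRetraction A HNNExtension.t = 1 := by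
  simp [hnnRetraction]

theorem stmt_2 (B : Type) [Group B] (Y : Finset B)
    (hY : Subgroup.closure (Y : Set B) = ⊤) (A : Subgroup B) (b : B) :
    wordLength (hnnGens A (Y : Set B)) (hnnOf A b) = wordLength (Y : Set B) b := by
  have hb : b ∈ Subgroup.closure (Y : Set B) := hY ▸ Subgroup.mem_top b
  apply le_antisymm
  · exact wordLength_map_le (hnnOf A) (fun y hy => .inl (.inl ⟨y, hy, rfl⟩)) hb
  · have hmem : hnnOf A b ∈ Subgroup.closure (hnnGens A (Y : Set B)) := by
      apply Subgroup.closure_mono Set.subset_union_left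
      rw [← MonoidHom.map_closure]
      exact Subgroup.mem_map_of_mem _ hb
    have h := wordLength_map_le (T := (Y : Set B)) (hnnRetraction A) ?_ hmem
    · rwa [hnnRetraction_hnnOf] at h
    · rintro _ (⟨y, hy, rfl⟩ | rfl)
      · exact .inl (by simpa using hy)
      · exact .inr (hnnRetraction_t A)
end

section
/- Let B be a group generated by a finite set Y, let A ≤ B be a subgroup, and let b ∈ B satisfy b⁻¹Ab ∩ A = {1}. Then for every M there exists D such that for all a, a′ ∈ A, if max(|a|_Y, |a′|_Y) ≥ D then |a·b·a′|_Y ≥ M. -/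
open scoped Pointwise in
theorem List.prod_mem_set_pow_length {G : Type*} [Monoid G] {S : Set G} (l : List G)
    (hl : ∀ x ∈ l, x ∈ S) : l.prod ∈ S ^ l.length := by
  induction l with
  | nil => simp
  | cons x l ih =>
    rw [List.prod_cons, List.length_cons, pow_succ']
    exact Set.mul_mem_mul (hl x (by simp)) (ih fun y hy => hl y (by simp [hy]))

open scoped Pointwise in
/-- Balls in a finitely generated group are finite. -/
theorem finite_setOf_wordLength_lt {G : Type*} [Group G] {S : Set G} (hfin : S.Finite)
    (hS : Subgroup.closure S = ⊤) (M : ℕ) : {g : G | wordLength S g < M}.Finite := by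
  have hpow (n : ℕ) : ((S ∪ S⁻¹) ^ n).Finite := by
    induction n with
    | zero => simp
    | succ n ih => rw [pow_succ]; exact ih.mul (hfin.union hfin.inv)
  refine ((Set.finite_Iio M).biUnion fun n _ => hpow n).subset fun g hg => ?_
  have hne : {n | ∃ l : List G, (∀ x ∈ l, x ∈ S ∪ S⁻¹) ∧ l.length = n ∧ l.prod = g}.Nonempty := by
    have hmem : g ∈ (Subgroup.closure S).toSubmonoid := by simp [hS]
    rw [Subgroup.closure_toSubmonoid] at hmem
    obtain ⟨l, hl, hprod⟩ := Submonoid.exists_list_of_mem_closure hmem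
    exact ⟨l.length, l, hl, rfl, hprod⟩
  obtain ⟨l, hl, hlen, hprod⟩ := Nat.sInf_mem hne
  refine Set.mem_biUnion (x := wordLength S g) hg ?_
  have h := List.prod_mem_set_pow_length l hl
  rwa [hlen, hprod] at h

/-- If `b⁻¹Ab` and `A` intersect trivially, then elements of the double coset `AbA` factor
uniquely. -/
theorem Subgroup.injOn_mul_mul_of_map_conj_inf_eq_bot {G : Type*} [Group G] {A : Subgroup G} {b : G}
    (hb : (Subgroup.map (MulAut.conj b⁻¹).toMonoidHom A) ⊓ A = ⊥) :
    Set.InjOn (fun p : G × G => p.1 * b * p.2) ((A : Set G) ×ˢ (A : Set G)) := by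
  rintro ⟨a, a'⟩ ⟨ha, ha'⟩ ⟨c, c'⟩ ⟨hc, hc'⟩ h
  simp only [SetLike.mem_coe] at ha ha' hc hc' h
  have key : b⁻¹ * (c⁻¹ * a) * b = c' * a'⁻¹ := by
    rw [eq_mul_inv_iff_mul_eq]
    calc b⁻¹ * (c⁻¹ * a) * b * a' = b⁻¹ * c⁻¹ * (a * b * a') := by group
      _ = c' := by rw [h]; group
  have hmem : c' * a'⁻¹ ∈ (Subgroup.map (MulAut.conj b⁻¹).toMonoidHom A) ⊓ A :=
    ⟨⟨c⁻¹ * a, A.mul_mem (A.inv_mem hc) ha, by simpa using key⟩, A.mul_mem hc' (A.inv_mem ha')⟩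
  rw [hb, Subgroup.mem_bot, mul_inv_eq_one] at hmem
  subst hmem
  simpa using h

theorem stmt_4 (B : Type) [Group B] (Y : Finset B)
    (hY : Subgroup.closure (Y : Set B) = ⊤) (A : Subgroup B) (b : B)
    (hb : (Subgroup.map (MulAut.conj b⁻¹).toMonoidHom A) ⊓ A = ⊥) :
    ∀ M : ℕ, ∃ D : ℕ, ∀ a ∈ A, ∀ a' ∈ A,
      D ≤ max (wordLength (Y : Set B) a) (wordLength (Y : Set B) a') →
      M ≤ wordLength (Y : Set B) (a * b * a') := by
  intro M
  have hfin := Set.Finite.preimage' (f := ((A : Set B) ×ˢ (A : Set B)).domRestrict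
      fun p : B × B => p.1 * b * p.2) (finite_setOf_wordLength_lt Y.finite_toSet hY M)
    fun g _ => (Set.subsingleton_singleton.preimage
      (Subgroup.injOn_mul_mul_of_map_conj_inf_eq_bot hb).injective).finite
  obtain ⟨D, hD⟩ := (hfin.image fun p => max (wordLength (Y : Set B) p.1.1)
    (wordLength (Y : Set B) p.1.2)).bddAbove
  refine ⟨D + 1, fun a ha a' ha' h => ?_⟩
  by_contra! hlt
  have := hD ⟨⟨(a, a'), ha, ha'⟩, hlt, rfl⟩
  exact absurd (h.trans this) (by simp)
end

section
/- Let B be a group generated by a finite set Y, let A ≤ B be a subgroup, and let b ∈ Y be an element with b ∉ A. Let U = ⟨B, t | t⁻¹at = a for all a ∈ A⟩ be the HNN extension with canonical embedding ι : B → U and stable letter t. Then for every natural number n, the word length of (t·ι(b))^{3n} in U with respect to ι(Y) ∪ {t} is exactly 6n. -/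
namespace HNNExtension

open NormalWord

variable {B : Type*} [Group B] (A : Subgroup B)

theorem mem_toSubgroup_self (u : ℤˣ) (g : B) : g ∈ toSubgroup A A u ↔ g ∈ A := by
  rcases Int.units_eq_one_or u with rfl | rfl <;> simp

theorem zpow_mul_of_mem (u : ℤˣ) {a : B} (ha : a ∈ A) :
    (t ^ (u : ℤ) * hnnOf A a : HNNExtension B A A (MulEquiv.refl A)) =
      hnnOf A a * t ^ (u : ℤ) := by
  have h : Commute (t : HNNExtension B A A (MulEquiv.refl A)) (hnnOf A a) :=
    t_mul_of (φ := MulEquiv.refl A) ⟨a, ha⟩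
  exact h.zpow_left u

open Classical in
/-- The least number of base letters needed to leave the subgroup `A` and reach `g`, capped at
one: it is `0` on `A` and `1` off `A`. -/
noncomputable def cosetCost (g : B) : ℕ := if g ∈ A then 0 else 1

theorem cosetCost_le_one (g : B) : cosetCost A g ≤ 1 := by
  unfold cosetCost; split_ifs <;> simp

variable {A} in
theorem cosetCost_of_mem {g : B} (hg : g ∈ A) : cosetCost A g = 0 := if_pos hg

variable {A} in
theorem cosetCost_of_notMem {g : B} (hg : g ∉ A) : cosetCost A g = 1 := if_neg hg

variable {A} in
theorem cosetCost_mul_of_mem {a : B} (ha : a ∈ A) (g : B) :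
    cosetCost A (a * g) = cosetCost A g := by
  have := A.mul_mem_cancel_left (y := g) ha
  unfold cosetCost; split_ifs <;> tauto

variable {A} in
theorem cosetCost_eq_of_inv_mul_mem {g h : B} (hgh : g⁻¹ * h ∈ A) :
    cosetCost A g = cosetCost A h := by
  have : h ∈ A ↔ g ∈ A := by
    conv_lhs => rw [← mul_inv_cancel_left g h]
    exact A.mul_mem_cancel_right hgh
  unfold cosetCost; split_ifs <;> tauto

namespace NormalWord.ReducedWord

variable {A}

/-- The number of stable letters of a reduced word plus the number of its base elements lying
outside `A`. -/
noncomputable def cost (w : ReducedWord B A A) : ℕ :=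
  cosetCost A w.head + (w.toList.map fun x => 1 + cosetCost A x.2).sum

theorem exists_prod_eq_of_mul (g : B) (w : ReducedWord B A A) :
    ∃ w' : ReducedWord B A A,
      w'.prod (MulEquiv.refl A) = hnnOf A g * w.prod (MulEquiv.refl A) ∧
      w'.cost ≤ w.cost + 1 := by
  refine ⟨⟨g * w.head, w.toList, w.chain⟩, by simp [ReducedWord.prod, hnnOf, mul_assoc], ?_⟩
  have := cosetCost_le_one A (g * w.head)
  simp only [cost]
  omega

theorem exists_prod_eq_zpow_mul (u : ℤˣ) (w : ReducedWord B A A) :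
    ∃ w' : ReducedWord B A A,
      w'.prod (MulEquiv.refl A) = t ^ (u : ℤ) * w.prod (MulEquiv.refl A) ∧
      w'.cost ≤ w.cost + 1 := by
  obtain ⟨g, l, hl⟩ := w
  by_cases hc : (l.map Prod.fst).head? = some (-u) ∧ g ∈ A
  · obtain ⟨hu, hg⟩ := hc
    obtain _ | ⟨⟨v, x⟩, l⟩ := l
    · simp at hu
    obtain rfl : v = -u := by simpa using hu
    refine ⟨⟨g * x, l, (List.isChain_cons.1 hl).2⟩, ?_, ?_⟩
    · have h := zpow_mul_of_mem A u hg
      simp only [hnnOf] at h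
      simp only [ReducedWord.prod, List.map_cons, List.prod_cons, map_mul, ← mul_assoc, h]
      simp
    · simp only [cost, cosetCost_mul_of_mem hg, List.map_cons, List.sum_cons]
      omega
  · refine ⟨⟨1, (u, g) :: l, List.isChain_cons.2 ⟨?_, hl⟩⟩, ?_, ?_⟩
    · rintro ⟨v, x⟩ hv hg
      rw [mem_toSubgroup_self] at hg
      by_contra hne
      refine hc ⟨?_, hg⟩
      rw [List.head?_map, Option.mem_def.1 hv]
      simpa using Int.units_ne_iff_eq_neg.1 (Ne.symm hne)
    · simp [ReducedWord.prod, mul_assoc]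
    · simp only [cost, cosetCost_of_mem A.one_mem, List.map_cons, List.sum_cons]
      omega

theorem exists_prod_eq_list_prod (Y : Set B) (l : List (HNNExtension B A A (MulEquiv.refl A)))
    (hl : ∀ x ∈ l, x ∈ hnnGens A Y ∪ (hnnGens A Y)⁻¹) :
    ∃ w : ReducedWord B A A, w.prod (MulEquiv.refl A) = l.prod ∧ w.cost ≤ l.length := by
  induction l with
  | nil =>
    exact ⟨ReducedWord.empty B A A, by simp [ReducedWord.prod],
      by simp [cost, cosetCost_of_mem A.one_mem]⟩
  | cons x l ih =>
    obtain ⟨w, hw, hwl⟩ := ih fun y hy => hl y (List.mem_cons_of_mem _ hy)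
    suffices h : ∃ w' : ReducedWord B A A,
        w'.prod (MulEquiv.refl A) = x * w.prod (MulEquiv.refl A) ∧ w'.cost ≤ w.cost + 1 by
      obtain ⟨w', hw', hwl'⟩ := h
      exact ⟨w', by rw [hw', hw, List.prod_cons], by rw [List.length_cons]; omega⟩
    rcases hl x List.mem_cons_self with (⟨y, -, rfl⟩ | hx) | (⟨y, -, hx⟩ | hx)
    · exact exists_prod_eq_of_mul y w
    · obtain rfl : x = t := hx
      simpa using exists_prod_eq_zpow_mul 1 w
    · obtain rfl : x = hnnOf A y⁻¹ := by rw [map_inv, hx, inv_inv]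
      exact exists_prod_eq_of_mul y⁻¹ w
    · obtain rfl : x = t⁻¹ := inv_eq_iff_eq_inv.1 hx
      simpa using exists_prod_eq_zpow_mul (-1) w

theorem le_cost_of_prod_eq {b : B} (hb : b ∉ A) (m : ℕ) (c : B) (w : ReducedWord B A A)
    (hw : w.prod (MulEquiv.refl A) = hnnOf A c * (t * hnnOf A b) ^ m) :
    2 * m + cosetCost A c ≤ w.cost := by
  have key : w.prod (MulEquiv.refl A) = ReducedWord.prod (MulEquiv.refl A)
      ⟨c, List.replicate m (1, b), List.isChain_replicate_of_rel m fun _ => rfl⟩ := by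
    rw [hw]
    simp [ReducedWord.prod, hnnOf]
  obtain ⟨hfst, hhead⟩ := HNNExtension.ReducedWord.map_fst_eq_and_of_prod_eq _ key
  obtain ⟨g, l, hl⟩ := w
  induction m generalizing c g l with
  | zero =>
    obtain rfl : l = [] := by simpa using hfst
    obtain rfl : g = c := of_injective (φ := MulEquiv.refl A)
      (by simpa [ReducedWord.prod, hnnOf] using hw)
    simp [cost]
  | succ m ih =>
    obtain _ | ⟨⟨v, x⟩, l⟩ := l
    · simp [List.replicate_succ] at hfst
    obtain rfl : v = 1 := by
      simp only [List.map_cons, List.replicate_succ, List.cons.injEq] at hfst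
      exact hfst.1
    have hgc : g⁻¹ * c ∈ A := by simpa using hhead 1 (by simp)
    have htail : ReducedWord.prod (MulEquiv.refl A) ⟨x, l, (List.isChain_cons.1 hl).2⟩ =
        hnnOf A (g⁻¹ * c * b) * (t * hnnOf A b) ^ m := by
      have h := zpow_mul_of_mem A 1 hgc
      simp only [Units.val_one, zpow_one, hnnOf] at h
      have hw' := congrArg (fun z => t⁻¹ * (of g⁻¹ * z)) hw
      simp only [ReducedWord.prod, List.map_cons, List.prod_cons, hnnOf, Units.val_one, zpow_one,
        map_inv, mul_assoc, inv_mul_cancel_left, pow_succ'] at hw' ⊢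
      rw [hw', inv_mul_eq_iff_eq_mul, map_mul, map_mul, map_inv]
      simp only [map_mul, map_inv] at h
      simp only [← mul_assoc] at h ⊢
      rw [h]
    have hkey : ReducedWord.prod (MulEquiv.refl A) ⟨x, l, (List.isChain_cons.1 hl).2⟩ =
        ReducedWord.prod (MulEquiv.refl A) ⟨g⁻¹ * c * b, List.replicate m (1, b),
          List.isChain_replicate_of_rel m fun _ => rfl⟩ := by
      rw [htail]
      simp [ReducedWord.prod, hnnOf]
    obtain ⟨hfst', hhead'⟩ := HNNExtension.ReducedWord.map_fst_eq_and_of_prod_eq _ hkey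
    have hcost := ih _ x l _ htail hkey hfst' hhead'
    rw [cosetCost_mul_of_mem hgc, cosetCost_of_notMem hb] at hcost
    have := cosetCost_eq_of_inv_mul_mem hgc
    simp only [cost, List.map_cons, List.sum_cons] at hcost ⊢
    omega

end NormalWord.ReducedWord

/-- In the HNN extension `⟨B, t ∣ t⁻¹at = a, a ∈ A⟩`, the word `(tb)^m` is geodesic whenever
`b ∉ A` is one of the chosen generators of `B`. -/
theorem wordLength_t_mul_of_pow {A} {Y : Set B} {b : B} (hbY : b ∈ Y) (hbA : b ∉ A) (m : ℕ) :
    wordLength (hnnGens A Y) ((t * hnnOf A b) ^ m) = 2 * m := by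
  refine IsLeast.csInf_eq ⟨⟨(List.replicate m [t, hnnOf A b]).flatten, ?_, ?_, ?_⟩, ?_⟩
  · intro x hx
    simp only [List.mem_flatten, List.mem_replicate] at hx
    obtain ⟨_, ⟨-, rfl⟩, hx⟩ := hx
    simp only [List.mem_cons, List.not_mem_nil, or_false] at hx
    rcases hx with rfl | rfl
    · exact Or.inl (Or.inr rfl)
    · exact Or.inl (Or.inl ⟨b, hbY, rfl⟩)
  · simp [mul_comm]
  · simp [List.prod_flatten]
  · rintro _ ⟨l, hl, rfl, hprod⟩
    obtain ⟨w, hw, hwl⟩ := ReducedWord.exists_prod_eq_list_prod Y l hl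
    have := ReducedWord.le_cost_of_prod_eq hbA m 1 w (by rw [hw, hprod, map_one, one_mul])
    omega

end HNNExtension

theorem stmt_5 (B : Type) [Group B] (Y : Finset B)
    (hY : Subgroup.closure (Y : Set B) = ⊤) (A : Subgroup B)
    (b : B) (hbY : b ∈ Y) (hbA : b ∉ A) (n : ℕ) :
    wordLength (hnnGens A (Y : Set B)) ((HNNExtension.t * hnnOf A b) ^ (3 * n)) = 6 * n := by
  rw [HNNExtension.wordLength_t_mul_of_pow (Finset.mem_coe.2 hbY) hbA]
  omega
end

section
/- Let B be a group generated by a finite set Y, let A ≤ B be a nontrivial subgroup, and let b ∈ Y satisfy b⁻¹Ab ∩ A = {1}. Let U = ⟨B, t | t⁻¹at = a for all a ∈ A⟩ be the HNN extension with canonical embedding ι : B → U and stable letter t, and endow U with the word metric with respect to X = ι(Y) ∪ {t}. Then for every real C ≥ 1 there exists D ≥ 0 such that for every n ≥ 1 and every finite sequence (word) W of elements of X ∪ X⁻¹ whose product in U equals (t·ι(b))^{3n} and whose length is at most 6Cn, there exist a prefix W′ of W (with product u ∈ U) and an integer k with n ≤ k ≤ 2n such that the word length of (t·ι(b))^{−k}·u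 with respect to X is at most D. -/
open scoped Classical in
/-- The signed number of crossings of the edge of the Bass–Serre tree stabilised by `A`. -/
theorem exists_edge_crossing_count {B : Type*} [Group B] (A : Subgroup B) :
    ∃ f : HNNExtension B A A (MulEquiv.refl A) → ℤ, f 1 = 0 ∧
      (∀ u β, f (u * hnnOf A β) = f u) ∧
      ∀ u, f (u * HNNExtension.t) = f u + if u ∈ A.map (hnnOf A) then 1 else 0 := by
  let U := HNNExtension B A A (MulEquiv.refl A)
  let T : Equiv.Perm (U × ℤ) :=
    { toFun := fun p => (HNNExtension.t * p.1,
        p.2 - if HNNExtension.t * p.1 ∈ A.map (hnnOf A) then 1 else 0)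
      invFun := fun p => (HNNExtension.t⁻¹ * p.1,
        p.2 + if p.1 ∈ A.map (hnnOf A) then 1 else 0)
      left_inv := fun p => by simp
      right_inv := fun p => by simp }
  let F : B →* Equiv.Perm (U × ℤ) :=
    { toFun := fun β =>
        { toFun := fun p => (hnnOf A β * p.1, p.2)
          invFun := fun p => ((hnnOf A β)⁻¹ * p.1, p.2)
          left_inv := fun p => by simp
          right_inv := fun p => by simp }
      map_one' := by ext p <;> simp
      map_mul' := fun x y => by ext p <;> simp [mul_assoc] }
  have hcomm : ∀ a : A, T * F a = F ((MulEquiv.refl A) a : B) * T := by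
    intro a
    have ha : (HNNExtension.t : U) * hnnOf A (a : B) = hnnOf A (a : B) * HNNExtension.t :=
      HNNExtension.t_mul_of a
    have ha' : hnnOf A (a : B) ∈ A.map (hnnOf A) := Subgroup.mem_map_of_mem _ a.2
    refine Equiv.ext fun p => ?_
    have h1 : (HNNExtension.t : U) * (hnnOf A (a : B) * p.1)
        = hnnOf A (a : B) * (HNNExtension.t * p.1) := by
      rw [← mul_assoc, ha, mul_assoc]
    simp only [T, F, Equiv.Perm.mul_apply, MonoidHom.coe_mk, OneHom.coe_mk, Equiv.coe_fn_mk,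
      MulEquiv.refl_apply, h1, Subgroup.mul_mem_cancel_left _ ha']
  let Φ : U →* Equiv.Perm (U × ℤ) := HNNExtension.lift F T hcomm
  have hΦt : Φ HNNExtension.t = T := HNNExtension.lift_t ..
  have hΦof : ∀ β, Φ (hnnOf A β) = F β := fun β => HNNExtension.lift_of ..
  have hfst : ∀ (x : U) p, (Φ x p).1 = x * p.1 := by
    intro x
    induction x using HNNExtension.induction_on with
    | of β => intro p; exact congrArg (fun e => (e p).1) (hΦof β)
    | t => intro p; rw [hΦt]; rfl
    | mul x y hx hy => intro p; rw [map_mul, Equiv.Perm.mul_apply, hx, hy, mul_assoc]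
    | inv x hx =>
      intro p
      have h := hx (Φ x⁻¹ p)
      rw [← Equiv.Perm.mul_apply, ← map_mul, mul_inv_cancel, map_one, Equiv.Perm.one_apply] at h
      rw [h, inv_mul_cancel_left]
  refine ⟨fun u => (Φ u⁻¹ (1, 0)).2, by simp, fun u β => ?_, fun u => ?_⟩
  · simp only [mul_inv_rev, map_mul, Equiv.Perm.mul_apply]
    rw [map_inv, hΦof]
    rfl
  · have h : (Φ u⁻¹ (1, 0)).1 = u⁻¹ := by rw [hfst, mul_one]
    simp only [mul_inv_rev, map_mul, Equiv.Perm.mul_apply]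
    rw [map_inv, hΦt]
    change (Φ u⁻¹ (1, 0)).2 + (if (Φ u⁻¹ (1, 0)).1 ∈ A.map (hnnOf A) then 1 else 0) = _
    rw [h, Subgroup.inv_mem_iff]

theorem t_mul_hnnOf_zpow_mem_iff {B : Type*} [Group B] (A : Subgroup B) (b : B) (j : ℤ) :
    ((HNNExtension.t * hnnOf A b) ^ j ∈ A.map (hnnOf A)) ↔ j = 0 := by
  refine ⟨?_, fun h => by simp [h]⟩
  rintro ⟨a, -, ha⟩
  let e : HNNExtension B A A (MulEquiv.refl A) →* Multiplicative ℤ :=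
    HNNExtension.lift 1 (Multiplicative.ofAdd 1) (by simp)
  have het : e HNNExtension.t = Multiplicative.ofAdd 1 := HNNExtension.lift_t ..
  have heof : ∀ β, e (hnnOf A β) = 1 := fun β => HNNExtension.lift_of ..
  have h := congrArg e ha
  rw [heof, map_zpow, map_mul, het, heof, mul_one, ← ofAdd_zsmul] at h
  simpa using h.symm

/-- Every path from `1` to `v` in the Cayley graph passes through `x • A`, provided the
corresponding edge is crossed a different number of times at `1` and at `v`. -/
theorem exists_prefix_mem {B : Type*} [Group B] {A : Subgroup B} {Y : Set B}
    {f : HNNExtension B A A (MulEquiv.refl A) → ℤ}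
    (hof : ∀ u β, f (u * hnnOf A β) = f u)
    (ht : ∀ u, u ∉ A.map (hnnOf A) → f (u * HNNExtension.t) = f u)
    (x : HNNExtension B A A (MulEquiv.refl A))
    (W : List (HNNExtension B A A (MulEquiv.refl A)))
    (hW : ∀ y ∈ W, y ∈ hnnGens A Y ∪ (hnnGens A Y)⁻¹)
    (hf : f (x * W.prod) ≠ f x) :
    ∃ W', W' <+: W ∧ x * W'.prod ∈ A.map (hnnOf A) := by
  induction W using List.reverseRecOn with
  | nil => simp at hf
  | append_singleton L y ih =>
    by_cases hL : f (x * L.prod) = f x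
    · have hne : f (x * L.prod * y) ≠ f (x * L.prod) := by
        simpa [mul_assoc, hL] using hf
      rcases hW y (by simp) with (⟨β, -, rfl⟩ | rfl) | (⟨β, -, hβ⟩ | hy)
      · exact absurd (hof _ _) hne
      · exact ⟨L, List.prefix_append _ _, by_contra fun h => hne (ht _ h)⟩
      · obtain rfl : y = hnnOf A β⁻¹ := by rw [map_inv, hβ, inv_inv]
        exact absurd (hof _ _) hne
      · obtain rfl : y = HNNExtension.t⁻¹ := by rw [← Set.mem_singleton_iff.1 hy, inv_inv]
        refine ⟨_, List.prefix_rfl, by_contra fun h => hne ?_⟩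
        have := ht _ h
        simpa [mul_assoc] using this.symm
    · obtain ⟨W', hW', h⟩ := ih (fun z hz => hW z (by simp [hz])) hL
      exact ⟨W', hW'.trans (List.prefix_append _ _), h⟩

theorem finite_prod_length_le {G : Type*} [Monoid G] {S : Set G} (hS : S.Finite) (N : ℕ) :
    {g : G | ∃ l : List G, (∀ x ∈ l, x ∈ S) ∧ l.length ≤ N ∧ l.prod = g}.Finite := by
  have : Finite S := hS
  refine ((List.finite_length_le S N).image fun l => (l.map Subtype.val).prod).subset ?_
  rintro g ⟨l, hl, hlen, rfl⟩
  refine ⟨l.attach.map fun x => ⟨x.1, hl _ x.2⟩, by simpa using hlen, ?_⟩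
  simp

theorem mul_inv_of_conj_eq {B : Type*} [Group B] {A : Subgroup B} {b : B}
    (hb : (Subgroup.map (MulAut.conj b⁻¹).toMonoidHom A) ⊓ A = ⊥)
    {a a' c c' : B} (ha : a ∈ A) (ha' : a' ∈ A) (hc : c ∈ A) (hc' : c' ∈ A)
    (h : a⁻¹ * b * a' = c⁻¹ * b * c') : a = c := by
  have key : b⁻¹ * (c * a⁻¹) * b = c' * a'⁻¹ := by
    calc b⁻¹ * (c * a⁻¹) * b = b⁻¹ * c * (a⁻¹ * b * a') * a'⁻¹ := by group
      _ = c' * a'⁻¹ := by rw [h]; group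
  have hmem : b⁻¹ * (c * a⁻¹) * b ∈
      (Subgroup.map (MulAut.conj b⁻¹).toMonoidHom A) ⊓ A :=
    ⟨⟨c * a⁻¹, A.mul_mem hc (A.inv_mem ha), by simp⟩,
      key ▸ A.mul_mem hc' (A.inv_mem ha')⟩
  rw [hb, Subgroup.mem_bot] at hmem
  have : c * a⁻¹ = 1 := by
    calc c * a⁻¹ = b * (b⁻¹ * (c * a⁻¹) * b) * b⁻¹ := by group
      _ = 1 := by rw [hmem]; group
  exact (mul_inv_eq_one.1 this).symm

theorem exists_gap_le (σ : ℕ → ℕ) (n : ℕ) (hn : 1 ≤ n) (K : ℝ)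
    (h : (σ (2 * n) : ℝ) ≤ K * n) :
    ∃ k, n ≤ k ∧ k + 1 ≤ 2 * n ∧ (σ (k + 1) : ℝ) ≤ σ k + K := by
  by_contra! hcon
  have hlow : ∀ m ≤ n, K * m ≤ (σ (n + m) : ℝ) := by
    intro m hm
    induction m with
    | zero => simp
    | succ m ih =>
      have := hcon (n + m) (by omega) (by omega)
      have := ih (by omega)
      push_cast
      rw [← add_assoc]
      linarith
  obtain ⟨m, rfl⟩ : ∃ m, n = m + 1 := ⟨n - 1, by omega⟩
  have h1 := hlow m (by omega)
  have h2 := hcon (m + 1 + m) (by omega) (by omega)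
  rw [show m + 1 + m + 1 = 2 * (m + 1) by ring] at h2
  push_cast at h
  linarith

theorem stmt_6 (B : Type) [Group B] (Y : Finset B)
    (hY : Subgroup.closure (Y : Set B) = ⊤)
    (A : Subgroup B) (hA : A ≠ ⊥)
    (b : B) (hbY : b ∈ Y)
    (hb : (Subgroup.map (MulAut.conj b⁻¹).toMonoidHom A) ⊓ A = ⊥)
    (C : ℝ) (hC : 1 ≤ C) :
    ∃ D : ℝ, 0 ≤ D ∧
      ∀ n : ℕ, 1 ≤ n →
      ∀ W : List (HNNExtension B A A (MulEquiv.refl A)),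
        (∀ x ∈ W, x ∈ hnnGens A (Y : Set B) ∪ (hnnGens A (Y : Set B))⁻¹) →
        W.prod = (HNNExtension.t * hnnOf A b) ^ (3 * n) →
        (W.length : ℝ) ≤ 6 * C * n →
        ∃ (W' : List (HNNExtension B A A (MulEquiv.refl A))) (k : ℕ),
          W' <+: W ∧ n ≤ k ∧ k ≤ 2 * n ∧
          (wordLength (hnnGens A (Y : Set B))
            (((HNNExtension.t * hnnOf A b) ^ k)⁻¹ * W'.prod) : ℝ) ≤ D := by
  classical
  let X := hnnGens A (Y : Set B)
  have hXfin : (X ∪ X⁻¹).Finite := by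
    have : X.Finite := (Y.finite_toSet.image _).union (Set.finite_singleton _)
    exact this.union this.inv
  let g : HNNExtension B A A (MulEquiv.refl A) := HNNExtension.t * hnnOf A b
  -- the elements of `A` which can occur at a short gap between consecutive edges
  let S : Set B := {a | a ∈ A ∧ ∃ a' ∈ A, (hnnOf A a)⁻¹ * g * hnnOf A a' ∈
    {g | ∃ l : List _, (∀ x ∈ l, x ∈ X ∪ X⁻¹) ∧ l.length ≤ ⌊6 * C⌋₊ ∧ l.prod = g}}
  have hSfin : S.Finite := by
    choose! φ hφA hφ using fun a (ha : a ∈ S) => ha.2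
    refine Set.Finite.of_finite_image (f := fun a => (hnnOf A a)⁻¹ * g * hnnOf A (φ a))
      ((finite_prod_length_le hXfin ⌊6 * C⌋₊).subset ?_) ?_
    · rintro _ ⟨a, ha, rfl⟩
      exact hφ a ha
    · intro a ha c hc hac
      have hcomm : ∀ a ∈ A, (hnnOf A a)⁻¹ * g * hnnOf A (φ a)
          = HNNExtension.t * hnnOf A (a⁻¹ * b * φ a) := by
        intro a ha
        have h : (HNNExtension.t : HNNExtension B A A (MulEquiv.refl A)) * hnnOf A a⁻¹
            = hnnOf A a⁻¹ * HNNExtension.t := HNNExtension.t_mul_of ⟨a⁻¹, A.inv_mem ha⟩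
        calc (hnnOf A a)⁻¹ * g * hnnOf A (φ a)
            = hnnOf A a⁻¹ * HNNExtension.t * (hnnOf A b * hnnOf A (φ a)) := by
              simp only [g, map_inv, mul_assoc]
          _ = HNNExtension.t * hnnOf A (a⁻¹ * b * φ a) := by
              rw [← h]
              simp only [map_mul, mul_assoc]
      dsimp only at hac
      rw [hcomm a ha.1, hcomm c hc.1] at hac
      exact mul_inv_of_conj_eq hb ha.1 (hφA a ha) hc.1 (hφA c hc)
        (HNNExtension.of_injective _ (mul_left_cancel hac))
  obtain ⟨D, hD⟩ := (hSfin.image fun a => wordLength X (hnnOf A a)).bddAbove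
  refine ⟨D, Nat.cast_nonneg _, fun n hn W hW hprod hlen => ?_⟩
  obtain ⟨f, hf1, hfof, hft⟩ := exists_edge_crossing_count A
  have hstep : ∀ j : ℤ, f (g ^ (j + 1)) = f (g ^ j) + if j = 0 then 1 else 0 := by
    intro j
    rw [zpow_add_one, ← mul_assoc, hfof, hft]
    simp only [g, t_mul_hnnOf_zpow_mem_iff]
  have hpos : ∀ m : ℕ, f (g ^ (m + 1)) = 1 := by
    intro m
    induction m with
    | zero => simpa [hf1] using hstep 0
    | succ m ih =>
      have := hstep (m + 1 : ℕ)
      rw [if_neg (by omega), add_zero] at this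
      rw [← ih]
      exact_mod_cast this
  have hneg : ∀ m : ℕ, f (g ^ m)⁻¹ = 0 := by
    intro m
    induction m with
    | zero => simpa using hf1
    | succ m ih =>
      have := hstep (-(m + 1 : ℕ))
      rw [if_neg (by omega), add_zero, show -((m + 1 : ℕ) : ℤ) + 1 = -(m : ℤ) by push_cast; ring,
        zpow_neg, zpow_neg, zpow_natCast, zpow_natCast, ih] at this
      exact this.symm
  -- `v` beyond the `k`-th edge is reached only after visiting that edge
  have hreach : ∀ k i, f ((g ^ k)⁻¹ * (W.take i).prod) = 1 →
      ∃ i' ≤ i, (g ^ k)⁻¹ * (W.take i').prod ∈ A.map (hnnOf A) := by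
    intro k i h
    obtain ⟨W', hW', h'⟩ := exists_prefix_mem (Y := (Y : Set B)) hfof
      (fun u hu => by rw [hft, if_neg hu, add_zero]) (g ^ k)⁻¹ (W.take i)
      (fun x hx => hW x (List.mem_of_mem_take hx)) (by rw [h, hneg]; exact one_ne_zero)
    refine ⟨W'.length, hW'.length_le.trans (by simp), ?_⟩
    rwa [← List.prefix_iff_eq_take.1 (hW'.trans (List.take_prefix _ _))]
  have hex : ∀ k, ∃ i, k ≤ 2 * n →
      i ≤ W.length ∧ (g ^ k)⁻¹ * (W.take i).prod ∈ A.map (hnnOf A) := by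
    intro k
    by_cases hk : k ≤ 2 * n
    · obtain ⟨m, hm⟩ : ∃ m, 3 * n = k + (m + 1) := ⟨3 * n - k - 1, by omega⟩
      obtain ⟨i, hi, h⟩ := hreach k W.length (by
        rw [List.take_length, hprod, hm, pow_add, inv_mul_cancel_left]
        exact hpos m)
      exact ⟨i, fun _ => ⟨hi, h⟩⟩
    · exact ⟨0, fun h => absurd h hk⟩
  let σ : ℕ → ℕ := fun k => Nat.find (hex k)
  have hσ : ∀ k ≤ 2 * n, σ k ≤ W.length ∧
      (g ^ k)⁻¹ * (W.take (σ k)).prod ∈ A.map (hnnOf A) := fun k => Nat.find_spec (hex k)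
  have hmono : ∀ k, k + 1 ≤ 2 * n → σ k ≤ σ (k + 1) := by
    intro k hk
    obtain ⟨hle, a, -, ha⟩ := hσ (k + 1) hk
    obtain ⟨i, hi, h⟩ := hreach k (σ (k + 1)) (by
      have : (g ^ k)⁻¹ * (W.take (σ (k + 1))).prod = g * hnnOf A a := by
        rw [ha, pow_succ]; group
      rw [this, hfof]
      simpa using hpos 0)
    exact (Nat.find_min' (hex k) fun _ => ⟨hi.trans hle, h⟩).trans hi
  obtain ⟨k, hnk, hk, hgap⟩ := exists_gap_le σ n hn (6 * C)
    (le_trans (by exact_mod_cast (hσ _ le_rfl).1) hlen)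
  have hkmono := hmono k hk
  obtain ⟨-, a, haA, ha⟩ := hσ k (by omega)
  obtain ⟨-, a', haA', ha'⟩ := hσ (k + 1) hk
  refine ⟨W.take (σ k), k, List.take_prefix _ _, hnk, by omega, ?_⟩
  rw [show HNNExtension.t * hnnOf A b = g from rfl, ← ha]
  refine Nat.cast_le.2 (hD ⟨a, ⟨haA, a', haA', ?_⟩, rfl⟩)
  refine ⟨(W.take (σ (k + 1))).drop (σ k),
    fun x hx => hW x (List.mem_of_mem_take (List.mem_of_mem_drop hx)), ?_, ?_⟩
  · refine Nat.le_floor ?_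
    have : ((W.take (σ (k + 1))).drop (σ k)).length ≤ σ (k + 1) - σ k := by simp; omega
    have h2 : ((σ (k + 1) - σ k : ℕ) : ℝ) ≤ 6 * C := by
      rw [Nat.cast_sub hkmono]; linarith
    exact le_trans (by exact_mod_cast this) h2
  · have h : (W.take (σ k)).prod * ((W.take (σ (k + 1))).drop (σ k)).prod
        = (W.take (σ (k + 1))).prod := by
      conv_rhs => rw [← List.prod_take_mul_prod_drop _ (σ k), List.take_take,
        min_eq_left hkmono]
    rw [ha, ha', eq_inv_mul_of_mul_eq h, pow_succ]
    group
end

section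
/- Let G be a group whose center Z(G) is a proper subgroup of G, and let U = ⟨G, t | t⁻¹at = a for all a ∈ Z(G)⟩ be the HNN extension of G with stable letter t centralizing Z(G), with canonical embedding ι : G → U. Then the center of U equals ι(Z(G)). -/
namespace HNNExtension

variable {G : Type*} [Group G] {A B : Subgroup G} (φ : A ≃* B)

open NormalWord

theorem exists_reducedWord_prod_eq (x : HNNExtension G A B φ) :
    ∃ w : ReducedWord G A B, w.prod φ = x := by
  obtain ⟨d⟩ := TransversalPair.nonempty G A B
  obtain ⟨w, hw⟩ := (NormalWord.equiv φ d).symm.surjective x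
  exact ⟨w.toReducedWord, hw⟩

/-- Multiplying a reduced word that involves the stable letter on the right by an element of the
base group changes neither the head of the word nor its pattern of stable letters. -/
theorem ReducedWord.exists_prod_eq_mul_of (w : ReducedWord G A B) (hw : w.toList ≠ []) (g : G) :
    ∃ w' : ReducedWord G A B, w'.prod φ = w.prod φ * of g ∧ w'.head = w.head ∧
      w'.toList.map Prod.fst = w.toList.map Prod.fst := by
  obtain ⟨head, l, chain⟩ := w
  obtain ⟨l, ⟨u, k⟩, rfl⟩ := List.eq_nil_or_concat' l |>.resolve_left hw
  refine ⟨⟨head, l ++ [(u, k * g)], ?_⟩, ?_, rfl, by simp⟩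
  · rw [List.isChain_append] at chain ⊢
    refine ⟨chain.1, List.isChain_singleton _, fun a ha b hb => ?_⟩
    simp only [List.head?_cons, Option.mem_def, Option.some.injEq] at hb
    subst hb
    exact chain.2.2 a ha (u, k) rfl
  · simp [NormalWord.ReducedWord.prod, mul_assoc]

/-- An element of an HNN extension commuting with the base group lies in the base group, provided
the associated subgroups are contained in a proper normal subgroup. -/
theorem mem_range_of_of_commute {N : Subgroup G} [N.Normal] (hN : N ≠ ⊤) (hA : A ≤ N)
    (hB : B ≤ N) {x : HNNExtension G A B φ} (hx : ∀ g : G, Commute (of g) x) :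
    x ∈ (of : G →* HNNExtension G A B φ).range := by
  obtain ⟨w, rfl⟩ := exists_reducedWord_prod_eq φ x
  by_cases hw : w.toList = []
  · exact ⟨w.head, by simp [NormalWord.ReducedWord.prod, hw]⟩
  refine absurd ((Subgroup.eq_top_iff' N).2 fun g => ?_) hN
  obtain ⟨w', hprod, hhead, hfst⟩ := ReducedWord.exists_prod_eq_mul_of φ w hw g
  have heq : w'.prod φ =
      NormalWord.ReducedWord.prod φ ⟨g * w.head, w.toList, w.chain⟩ := by
    rw [hprod, ← (hx g).eq]
    simp [NormalWord.ReducedWord.prod, mul_assoc]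
  obtain ⟨a, ha⟩ := Option.ne_none_iff_exists'.1 (mt List.head?_eq_none_iff.1 hw)
  have hmem := (ReducedWord.map_fst_eq_and_of_prod_eq φ heq).2 a.1
    (by rw [← List.head?_map, hfst, List.head?_map, ha]; rfl)
  have hle : toSubgroup A B (-a.1) ≤ N := by
    unfold toSubgroup
    split_ifs <;> assumption
  have hconj := hle hmem
  rw [hhead] at hconj
  simpa [mul_assoc] using Subgroup.Normal.conj_mem ‹_› _ hconj w.head

end HNNExtension


theorem stmt_10 (G : Type) [Group G] (h : Subgroup.center G ≠ ⊤) :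
    Subgroup.center
        (HNNExtension G (Subgroup.center G) (Subgroup.center G)
          (MulEquiv.refl (Subgroup.center G))) =
      Subgroup.map
        (HNNExtension.of :
          G →* HNNExtension G (Subgroup.center G) (Subgroup.center G)
            (MulEquiv.refl (Subgroup.center G)))
        (Subgroup.center G) := by
  apply le_antisymm
  · intro x hx
    rw [Subgroup.mem_center_iff] at hx
    obtain ⟨g, rfl⟩ := HNNExtension.mem_range_of_of_commute _ h le_rfl le_rfl
      fun k => hx (HNNExtension.of k)
    refine ⟨g, Subgroup.mem_center_iff.2 fun k => ?_, rfl⟩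
    exact HNNExtension.of_injective (φ := MulEquiv.refl (Subgroup.center G))
      (by simpa using hx (HNNExtension.of k))
  · rintro _ ⟨g, hg, rfl⟩
    rw [Subgroup.mem_center_iff]
    intro x
    change Commute x _
    induction x using HNNExtension.induction_on with
    | of k => exact Commute.map (Subgroup.mem_center_iff.1 hg k) _
    | t => exact HNNExtension.t_mul_of ⟨g, hg⟩
    | mul x y hx hy => exact hx.mul_left hy
    | inv x hx => exact hx.inv_left
end

section
/- Let B be a group, A ≤ B a subgroup, and U = ⟨B, t | t⁻¹at = a for all a ∈ A⟩ the HNN extension with canonical embedding ι : B → U and stable letter t. Consider the two homomorphisms from B to U given by g ↦ ι(g) and g ↦ t⁻¹·ι(g)·t; they agree on A, and hence induce a homomorphism from the amalgamated free product B *_A B (the pushout of the two inclusions A ↪ B) to U. This induced homomorphism is injective; in particular, the subgroup of U generated by ι(B) ∪ t⁻¹ι(B)t is isomorphic to B *_A B. -/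
namespace Monoid.PushoutI

variable {B : Type*} [Group B] (A : Subgroup B)

theorem of_subtype_eq_of_subtype (i j : Bool) (a : A) :
    of (φ := fun _ : Bool => A.subtype) i (a : B) =
      of (φ := fun _ : Bool => A.subtype) j (a : B) :=
  (of_apply_eq_base (fun _ : Bool => A.subtype) i a).trans
    (of_apply_eq_base (fun _ : Bool => A.subtype) j a).symm

/-- The endomorphism of `B *_A B` exchanging the two factors. -/
def swapHom : PushoutI (fun _ : Bool => A.subtype) →* PushoutI (fun _ : Bool => A.subtype) :=
  lift (fun i => of (φ := fun _ : Bool => A.subtype) (!i)) (base _)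
    fun i => of_comp_eq_base (φ := fun _ : Bool => A.subtype) (!i)

@[simp]
theorem swapHom_of (i : Bool) (b : B) :
    swapHom A (of (φ := fun _ : Bool => A.subtype) i b) =
      of (φ := fun _ : Bool => A.subtype) (!i) b :=
  lift_of _ _ _ _

theorem swapHom_comp_swapHom : (swapHom A).comp (swapHom A) = MonoidHom.id _ :=
  hom_ext_nonempty fun i => by ext b; simp

/-- The automorphism of `B *_A B` exchanging the two factors. -/
def swap : MulAut (PushoutI (fun _ : Bool => A.subtype)) :=
  (swapHom A).toMulEquiv (swapHom A) (swapHom_comp_swapHom A) (swapHom_comp_swapHom A)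

@[simp]
theorem swap_of (i : Bool) (b : B) :
    swap A (of (φ := fun _ : Bool => A.subtype) i b) =
      of (φ := fun _ : Bool => A.subtype) (!i) b :=
  swapHom_of A i b

@[simp]
theorem swap_symm_of (i : Bool) (b : B) :
    (swap A).symm (of (φ := fun _ : Bool => A.subtype) i b) =
      of (φ := fun _ : Bool => A.subtype) (!i) b :=
  swapHom_of A i b

end Monoid.PushoutI

open Monoid in
/-- The homomorphism from the HNN extension to the semidirect product of `B *_A B` with its
automorphism group, sending `B` to the first factor and `t` to the swap of the two factors. -/
def hnnToSemidirect {B : Type*} [Group B] (A : Subgroup B) :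
    HNNExtension B A A (MulEquiv.refl A) →*
      PushoutI (fun _ : Bool => A.subtype) ⋊[MonoidHom.id _]
        MulAut (PushoutI (fun _ : Bool => A.subtype)) :=
  HNNExtension.lift (SemidirectProduct.inl.comp (PushoutI.of (φ := fun _ : Bool => A.subtype) false))
    (SemidirectProduct.inr (PushoutI.swap A)) fun a => by
      ext1
      · simpa using PushoutI.of_subtype_eq_of_subtype A true false a
      · simp

theorem stmt_13 (B : Type) [Group B] (A : Subgroup B)
    (f : Monoid.PushoutI (fun _ : Bool => A.subtype) →*
      HNNExtension B A A (MulEquiv.refl A))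
    (hf₁ : ∀ b : B,
      f (Monoid.PushoutI.of (φ := fun _ : Bool => A.subtype) false b) = hnnOf A b)
    (hf₂ : ∀ b : B,
      f (Monoid.PushoutI.of (φ := fun _ : Bool => A.subtype) true b) =
        HNNExtension.t⁻¹ * hnnOf A b * HNNExtension.t) :
    Function.Injective f ∧
    Nonempty
      ((Subgroup.closure
          (((hnnOf A).range : Set (HNNExtension B A A (MulEquiv.refl A))) ∪
            ((fun x => HNNExtension.t⁻¹ * x * HNNExtension.t) ''
              ((hnnOf A).range : Set (HNNExtension B A A (MulEquiv.refl A)))))) ≃*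
        Monoid.PushoutI (fun _ : Bool => A.subtype)) := by
  have hinj : Function.Injective f := by
    have hcomp : (hnnToSemidirect A).comp f = SemidirectProduct.inl := by
      refine Monoid.PushoutI.hom_ext_nonempty fun i => ?_
      ext1 b
      cases i
      · simp [hf₁, hnnOf, hnnToSemidirect]
      · ext1 <;> simp [hf₂, hnnOf, hnnToSemidirect]
    refine Function.Injective.of_comp (f := hnnToSemidirect A) ?_
    rw [← MonoidHom.coe_comp, hcomp]
    exact SemidirectProduct.inl_injective
  refine ⟨hinj, ⟨(MulEquiv.subgroupCongr ?_).trans (MonoidHom.ofInjective hinj).symm⟩⟩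
  apply le_antisymm
  · rw [Subgroup.closure_le]
    rintro _ (⟨b, rfl⟩ | ⟨_, ⟨b, rfl⟩, rfl⟩)
    · exact ⟨_, hf₁ b⟩
    · exact ⟨_, hf₂ b⟩
  · rintro _ ⟨x, rfl⟩
    have hof (i : Bool) (b : B) :
        f (Monoid.PushoutI.of (φ := fun _ : Bool => A.subtype) i b) ∈ Subgroup.closure
          (((hnnOf A).range : Set (HNNExtension B A A (MulEquiv.refl A))) ∪
            ((fun x => HNNExtension.t⁻¹ * x * HNNExtension.t) ''
              ((hnnOf A).range : Set (HNNExtension B A A (MulEquiv.refl A))))) := by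
      cases i
      · exact Subgroup.subset_closure (.inl ⟨b, (hf₁ b).symm⟩)
      · exact Subgroup.subset_closure (.inr ⟨_, ⟨b, rfl⟩, (hf₂ b).symm⟩)
    induction x using Monoid.PushoutI.induction_on with
    | of i b => exact hof i b
    | base a =>
      rw [← Monoid.PushoutI.of_apply_eq_base _ false]
      exact hof false a
    | mul x y hx hy => rw [map_mul]; exact mul_mem hx hy
end
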